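/- Let α : 𝕍 → 𝕌 be a morphism between persistence modules of length n. Then for all 1 ≤ a' ≤ b' ≤ n: Σ_{b = 1}^{n} Σ_{a = 1}^{b} M^α(a, b, a', b') ≤ dim S_{a',b'}^𝕌 − dim S_{a'−1,b'}^𝕌 = D^𝕌(a', b'). -/

import Mathlib

open Module Submodule LinearMap Finset

noncomputable section

/-- A persistence module of length `n` over a field `F`: finite-dimensional vector
spaces `V i` (indexed by `ℤ`, with the convention that `V i` is trivial for `i < 1`
or `i > n`) together with structure maps `f i : V i → V (i+1)`. -/
structure PersMod (F : Type) [Field F] (n : ℕ) where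
  V : ℤ → Type
  [acg : ∀ i, AddCommGroup (V i)]
  [mod : ∀ i, Module F (V i)]
  [fd : ∀ i, FiniteDimensional F (V i)]
  f : ∀ i : ℤ, V i →ₗ[F] V (i + 1)
  triv : ∀ i : ℤ, (i < 1 ∨ (n : ℤ) < i) → Subsingleton (V i)

attribute [instance] PersMod.acg PersMod.mod PersMod.fd

variable {F : Type} [Field F] {n : ℕ}

/-- Transport along an index equality. -/
def PersMod.castLM (M : PersMod F n) {i j : ℤ} (h : i = j) : M.V i →ₗ[F] M.V j := by
  subst h; exact LinearMap.id

def PersMod.flAux (M : PersMod F n) (a : ℤ) : (k : ℕ) → (M.V a →ₗ[F] M.V (a + (k : ℤ)))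
  | 0 => M.castLM (by simp)
  | (k + 1) => (M.castLM (by push_cast; ring)).comp ((M.f (a + (k : ℤ))).comp (M.flAux a k))

/-- The composite structure map `f_{a,b} : V a → V b` (the zero map if `b < a`);
`fl a a` is the identity. -/
def PersMod.fl (M : PersMod F n) (a b : ℤ) : M.V a →ₗ[F] M.V b :=
  if h : a ≤ b then (M.castLM (by omega)).comp (M.flAux a (b - a).toNat) else 0

/-- `S M a b = f_{a,b}(V a) ⊓ ker (f b)` when `1 ≤ a ≤ b ≤ n`, and `⊥` otherwise. -/
def PersMod.S (M : PersMod F n) (a b : ℤ) : Submodule F (M.V b) :=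
  if 1 ≤ a ∧ a ≤ b ∧ b ≤ (n : ℤ) then
    LinearMap.range (M.fl a b) ⊓ LinearMap.ker (M.f b)
  else ⊥

/-- The persistence diagram `D M a b = dim S_{a,b} - dim S_{a-1,b}` (as an integer). -/
def PersMod.D (M : PersMod F n) (a b : ℤ) : ℤ :=
  (Module.finrank F ↥(M.S a b) : ℤ) - (Module.finrank F ↥(M.S (a - 1) b) : ℤ)

/-- A morphism of persistence modules: linear maps commuting with structure maps. -/
structure PersHom (M N : PersMod F n) where
  α : ∀ i : ℤ, M.V i →ₗ[F] N.V i
  comm : ∀ i : ℤ, (N.f i).comp (α i) = (α (i + 1)).comp (M.f i)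

/-- `X^α(a,b,a',b')` from the paper. -/
def PersHom.X {M N : PersMod F n} (h : PersHom M N) (a b a' b' : ℤ) : ℤ :=
  if b' ≤ b ∧ b ≤ (n : ℤ) then
    (Module.finrank F
        ↥(M.S a b ⊓ Submodule.map (M.fl b' b) (Submodule.comap (h.α b') (N.S a' b'))) : ℤ)
      - (Module.finrank F
        ↥(M.S a b ⊓ Submodule.map (M.fl b' b) (LinearMap.ker (h.α b'))) : ℤ)
  else 0

/-- The basis-independent partial matching `M^α` induced by `α`. -/
def PersHom.Mm {M N : PersMod F n} (h : PersHom M N) (a b a' b' : ℤ) : ℤ :=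
  h.X a b a' b' - h.X (a - 1) b a' b' - h.X a b (a' - 1) b' + h.X (a - 1) b (a' - 1) b'

/-- The elder rule operator in the `i`-th variable. -/
def Efun {m : ℕ} (i : Fin m) (G : (Fin m → ℤ) → ℤ) : (Fin m → ℤ) → ℤ :=
  fun x => G x - G (Function.update x i (x i - 1))

/-- The restriction of a persistence module to a family of subspaces preserved
by the structure maps. -/
def PersMod.restrict (M : PersMod F n) (P : ∀ i : ℤ, Submodule F (M.V i))
    (hP : ∀ i : ℤ, Submodule.map (M.f i) (P i) ≤ P (i + 1)) : PersMod F n where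
  V i := ↥(P i)
  f i := (M.f i).restrict (fun x hx => hP i ⟨x, hx, rfl⟩)
  triv i hi := by
    have h := M.triv i hi
    exact ⟨fun a b => Subtype.ext (@Subsingleton.elim _ h _ _)⟩

/-- The restriction of a morphism of persistence modules to preserved families of
subspaces on source and target. -/
def PersHom.restrict {M N : PersMod F n} (h : PersHom M N)
    (P : ∀ i : ℤ, Submodule F (M.V i))
    (hP : ∀ i : ℤ, Submodule.map (M.f i) (P i) ≤ P (i + 1))
    (Q : ∀ i : ℤ, Submodule F (N.V i))
    (hQ : ∀ i : ℤ, Submodule.map (N.f i) (Q i) ≤ Q (i + 1))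
    (hα : ∀ i : ℤ, Submodule.map (h.α i) (P i) ≤ Q i) :
    PersHom (M.restrict P hP) (N.restrict Q hQ) where
  α i := (h.α i).restrict (fun x hx => hα i ⟨x, hx, rfl⟩)
  comm i := by
    ext x
    apply Subtype.ext
    show (N.f i) ((h.α i) x.1) = (h.α (i + 1)) ((M.f i) x.1)
    exact LinearMap.congr_fun (h.comm i) x.1

/-- The subspace `R(a,b,c,d)` (respectively `L(a',b',c,d)`, with `β` in place of `α`). -/
def RL {V W : PersMod F n} (α : PersHom V W) (a b c d : ℤ) : Submodule F (W.V d) :=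
  if a ≤ d ∧ c ≤ d ∧ d ≤ b then
    Submodule.map (α.α d) (LinearMap.range (V.fl a d) ⊓ LinearMap.ker (V.fl d (b + 1)))
      ⊓ W.S c d
  else ⊥

/-- `Y(a,b,a',b',c,d) = dim (R(a,b,c,d) ⊓ L(a',b',c,d))`. -/
def Yfun {V W U : PersMod F n} (α : PersHom V W) (β : PersHom U W)
    (a b a' b' c d : ℤ) : ℤ :=
  (Module.finrank F ↥(RL α a b c d ⊓ RL β a' b' c d) : ℤ)

/-- `e_{c,d} = E_{1,2,3,4,5}(Y)(a,b,a',b',c,d)`. -/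
def eG {V W U : PersMod F n} (α : PersHom V W) (β : PersHom U W)
    (a b a' b' c d : ℤ) : ℤ :=
  Efun (4 : Fin 6) (Efun 3 (Efun 2 (Efun 1 (Efun 0
    (fun x : Fin 6 → ℤ => Yfun α β (x 0) (x 1) (x 2) (x 3) (x 4) (x 5))))))
    ![a, b, a', b', c, d]

/-- The cardinality (with multiplicity) `#G^{α,β}(a,b,a',b')` of the enriched partial
matching: the sum of all positive `e_{c,d}` over `1 ≤ c ≤ d ≤ n`. -/
def cardG {V W U : PersMod F n} (α : PersHom V W) (β : PersHom U W)
    (a b a' b' : ℤ) : ℤ :=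
  ∑ d ∈ Finset.Icc (1 : ℤ) (n : ℤ), ∑ c ∈ Finset.Icc (1 : ℤ) d,
    if 0 < eG α β a b a' b' c d then eG α β a b a' b' c d else 0

theorem castLM_rfl (M : PersMod F n) {i : ℤ} (h : i = i) : M.castLM h = LinearMap.id := rfl

theorem fl_eq (M : PersMod F n) {a b : ℤ} (m : ℕ) (h : a + (m : ℤ) = b) :
    M.fl a b = (M.castLM h).comp (M.flAux a m) := by
  have hm : m = (b - a).toNat := by omega
  subst hm
  have hab : a ≤ b := by omega
  simp [PersMod.fl, hab]

theorem castLM_self (M : PersMod F n) (a : ℤ) : M.fl a a = LinearMap.id := by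
  rw [fl_eq M 0 (by simp)]
  have key : ∀ (c : ℤ) (h1 : a = c) (h2 : c = a),
      (M.castLM h2).comp (M.castLM h1) = LinearMap.id := by
    intro c h1 h2
    subst h1
    rfl
  exact key _ _ _

theorem fl_succ (M : PersMod F n) {a b : ℤ} (hab : a ≤ b) :
    M.fl a (b + 1) = (M.f b).comp (M.fl a b) := by
  obtain ⟨k, rfl⟩ : ∃ k : ℕ, b = a + (k : ℤ) := ⟨(b - a).toNat, by omega⟩
  rw [fl_eq M k rfl, fl_eq M (k + 1) (by push_cast; ring), castLM_rfl, LinearMap.id_comp]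
  have key : ∀ (c d : ℤ) (h1 : d = c) (h2 : c = d) (g : M.V a →ₗ[F] M.V d),
      (M.castLM h2).comp ((M.castLM h1).comp g) = g := by
    intro c d h1 h2 g
    subst h1
    rfl
  exact key _ _ _ _ _

theorem fl_pred (M : PersMod F n) {a b : ℤ} (hab : a + 1 ≤ b) :
    M.fl a b = (M.fl (a + 1) b).comp (M.f a) := by
  induction b, hab using Int.le_induction with
  | base =>
    rw [castLM_self, fl_succ M le_rfl, castLM_self]
    rfl
  | succ b hb ih =>
    rw [fl_succ M hb, fl_succ M (by omega), ih]
    rfl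

theorem S_mono (M : PersMod F n) {a b : ℤ} : a ≤ b → M.S (a - 1) b ≤ M.S a b := by
  intro hab
  unfold PersMod.S
  split_ifs with h1 h2 h2
  · obtain ⟨c, rfl⟩ : ∃ c, a = c + 1 := ⟨a - 1, by ring⟩
    rw [add_sub_cancel_right, fl_pred M hab]
    exact inf_le_inf_right _ (LinearMap.range_comp_le_range _ _)
  · omega
  · exact bot_le
  · exact le_rfl

theorem tele (G : ℤ → ℤ) (m : ℕ) :
    ∑ b ∈ Finset.Icc (1 : ℤ) (m : ℤ), (G b - G (b - 1)) = G m - G 0 := by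
  induction m with
  | zero => simp
  | succ m ih =>
    have : Finset.Icc (1 : ℤ) ((m + 1 : ℕ) : ℤ)
        = insert ((m : ℤ) + 1) (Finset.Icc (1 : ℤ) (m : ℤ)) := by
      ext x
      simp only [Finset.mem_Icc, Finset.mem_insert]
      omega
    rw [this, Finset.sum_insert (by simp), ih]
    push_cast
    rw [add_sub_cancel_right]
    ring

theorem finrank_step {V W : Type} [AddCommGroup V] [AddCommGroup W] [Module F V] [Module F W]
    [FiniteDimensional F V] (f : V →ₗ[F] W) (A : Submodule F V) :
    (Module.finrank F ↥(LinearMap.ker f ⊓ A) : ℤ)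
      = (Module.finrank F ↥A : ℤ) - (Module.finrank F ↥(A.map f) : ℤ) := by
  have h := LinearMap.finrank_range_add_finrank_ker (f.domRestrict A)
  rw [LinearMap.range_domRestrict] at h
  have h2 : Module.finrank F ↥(LinearMap.ker (f.domRestrict A))
      = Module.finrank F ↥(LinearMap.ker f ⊓ A) := by
    have e : LinearMap.ker f ⊓ A = (LinearMap.ker (f.domRestrict A)).map A.subtype := by
      ext x
      simp only [Submodule.mem_inf, LinearMap.mem_ker, Submodule.mem_map, Subtype.exists,
        LinearMap.domRestrict_apply, Submodule.subtype_apply, exists_and_left, exists_prop,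
        exists_eq_right_right]
    rw [e]
    exact (Submodule.equivMapOfInjective A.subtype A.injective_subtype _).finrank_eq
  omega

theorem finrank_comap_le {V W : Type} [AddCommGroup V] [AddCommGroup W] [Module F V] [Module F W]
    [FiniteDimensional F V] [FiniteDimensional F W] (f : V →ₗ[F] W) (S T : Submodule F W)
    (hTS : T ≤ S) :
    (Module.finrank F ↥(S.comap f) : ℤ) - (Module.finrank F ↥(T.comap f) : ℤ)
      ≤ (Module.finrank F ↥S : ℤ) - (Module.finrank F ↥T : ℤ) := by
  have h1 := finrank_step (T.mkQ.comp f) (S.comap f)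
  have h2 := finrank_step T.mkQ S
  have e1 : LinearMap.ker (T.mkQ.comp f) ⊓ S.comap f = T.comap f := by
    rw [LinearMap.ker_comp, Submodule.ker_mkQ, inf_eq_left]
    exact Submodule.comap_mono hTS
  have e2 : LinearMap.ker T.mkQ ⊓ S = T := by
    rw [Submodule.ker_mkQ, inf_eq_left]
    exact hTS
  rw [e1] at h1
  rw [e2] at h2
  have h3 : (S.comap f).map (T.mkQ.comp f) ≤ S.map T.mkQ := by
    rw [Submodule.map_comp]
    exact Submodule.map_mono (Submodule.map_comap_le _ _)
  have h4 := Submodule.finrank_mono h3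
  omega

theorem S_self (M : PersMod F n) {b : ℤ} (h1 : 1 ≤ b) (h2 : b ≤ n) :
    M.S b b = LinearMap.ker (M.f b) := by
  unfold PersMod.S
  rw [if_pos ⟨h1, le_rfl, h2⟩, castLM_self, LinearMap.range_id, top_inf_eq]

theorem X_zero {M N : PersMod F n} (h : PersHom M N) (b a' b' : ℤ) : h.X 0 b a' b' = 0 := by
  have : M.S 0 b = ⊥ := by
    unfold PersMod.S
    rw [if_neg (by omega)]
  unfold PersHom.X
  split_ifs
  · rw [this, bot_inf_eq, bot_inf_eq, sub_self]
  · rfl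

/-- dimension of the image of `A` in `V_b`. -/
def gdim (M : PersMod F n) (b' : ℤ) (A : Submodule F (M.V b')) (b : ℤ) : ℤ :=
  (Module.finrank F ↥(A.map (M.fl b' b)) : ℤ)

theorem gdim_step (M : PersMod F n) {b' b : ℤ} (A : Submodule F (M.V b')) (h1 : 1 ≤ b)
    (h2 : b ≤ n) (hb : b' ≤ b) :
    (Module.finrank F ↥(M.S b b ⊓ A.map (M.fl b' b)) : ℤ)
      = gdim M b' A b - gdim M b' A (b + 1) := by
  rw [S_self M h1 h2, finrank_step, ← Submodule.map_comp, ← fl_succ M hb]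
  rfl

theorem gdim_tele (M : PersMod F n) {b' : ℤ} (A : Submodule F (M.V b')) (h1 : 1 ≤ b')
    (h2 : b' ≤ n) :
    ∑ b ∈ Finset.Icc (1 : ℤ) (n : ℤ),
      (gdim M b' A (max b' b) - gdim M b' A (max b' (b + 1))) = Module.finrank F ↥A := by
  have h := tele (fun b => - gdim M b' A (max b' (b + 1))) n
  have e0 : max b' ((0 : ℤ) + 1) = b' := by omega
  have e1 : max b' ((n : ℤ) + 1) = n + 1 := by omega
  have g1 : gdim M b' A (n + 1) = 0 := by
    have := M.triv (n + 1) (Or.inr (by omega))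
    unfold gdim
    rw [Module.finrank_zero_of_subsingleton]
    rfl
  have g0 : gdim M b' A b' = Module.finrank F ↥A := by
    unfold gdim
    rw [castLM_self, Submodule.map_id]
  simp only [e0, e1, g1, g0] at h
  rw [neg_zero, zero_sub, neg_neg] at h
  rw [← h]
  refine Finset.sum_congr rfl fun b _ => ?_
  rw [sub_add_cancel]
  ring

theorem sum_Mm {M N : PersMod F n} (h : PersHom M N) {a' b' b : ℤ} (h1 : 1 ≤ b) (h2 : b ≤ n) :
    ∑ a ∈ Finset.Icc (1 : ℤ) b, h.Mm a b a' b'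
      = (gdim M b' ((N.S a' b').comap (h.α b')) (max b' b)
          - gdim M b' ((N.S a' b').comap (h.α b')) (max b' (b + 1)))
        - (gdim M b' ((N.S (a' - 1) b').comap (h.α b')) (max b' b)
          - gdim M b' ((N.S (a' - 1) b').comap (h.α b')) (max b' (b + 1))) := by
  have ht := tele (fun a => h.X a b a' b' - h.X a b (a' - 1) b') b.toNat
  have hb : ((b.toNat : ℕ) : ℤ) = b := by omega
  simp only [hb, X_zero] at ht
  have e : ∑ a ∈ Finset.Icc (1 : ℤ) b, h.Mm a b a' b' = h.X b b a' b' - h.X b b (a' - 1) b' := by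
    rw [sub_zero, sub_zero] at ht
    rw [← ht]
    refine Finset.sum_congr rfl fun a _ => ?_
    unfold PersHom.Mm
    ring
  rw [e]
  unfold PersHom.X
  by_cases hc : b' ≤ b
  · rw [if_pos ⟨hc, h2⟩, if_pos ⟨hc, h2⟩, gdim_step M ((N.S a' b').comap (h.α b')) h1 h2 hc,
      gdim_step M ((N.S (a' - 1) b').comap (h.α b')) h1 h2 hc,
      max_eq_right hc, max_eq_right (by omega : b' ≤ b + 1)]
    ring
  · rw [if_neg (fun x => hc x.1), if_neg (fun x => hc x.1), max_eq_left (by omega),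
      max_eq_left (by omega)]
    ring

/-- Theorem 2 of the paper, second inequality:
`∑_{b=1}^{n} ∑_{a=1}^{b} M^α(a,b,a',b') ≤ dim S^U_{a',b'} - dim S^U_{a'-1,b'} = D^U(a',b')`. -/
theorem stmt11 (Vm Um : PersMod F n) (h : PersHom Vm Um) (a' b' : ℤ)
    (ha' : 1 ≤ a') (hab' : a' ≤ b') (hb'n : b' ≤ (n : ℤ)) :
    (∑ b ∈ Finset.Icc (1 : ℤ) (n : ℤ), ∑ a ∈ Finset.Icc (1 : ℤ) b, h.Mm a b a' b') ≤
        (Module.finrank F ↥(Um.S a' b') : ℤ) - (Module.finrank F ↥(Um.S (a' - 1) b') : ℤ) ∧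
      (Module.finrank F ↥(Um.S a' b') : ℤ) - (Module.finrank F ↥(Um.S (a' - 1) b') : ℤ) =
        Um.D a' b' := by
  refine ⟨?_, rfl⟩
  rw [Finset.sum_congr rfl fun b hb =>
    sum_Mm h (Finset.mem_Icc.1 hb).1 (Finset.mem_Icc.1 hb).2, Finset.sum_sub_distrib,
    gdim_tele Vm _ (by omega) hb'n, gdim_tele Vm _ (by omega) hb'n]
  exact finrank_comap_le _ _ _ (S_mono Um hab')
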